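/- If n is a positive integer and X is a separable metric space with dim_T X ≥ n, then d^n_H(X) ≤ dim_H X − n. -/

import Mathlib

open Set Metric Filter Topology TopologicalSpace
open scoped ENNReal NNReal

noncomputable section

universe u

/-- `indBelow n X` means that the small inductive (topological) dimension of `X`
is at most `n - 1`; in particular `indBelow 0 X` means `X = ∅`. -/
def indBelow : ℕ → ∀ (X : Type u) [TopologicalSpace X], Prop
  | 0, X, _ => IsEmpty X
  | n + 1, X, inst =>
      letI := inst
      ∀ (x : X) (U : Set X), IsOpen U → x ∈ U →
        ∃ V : Set X, IsOpen V ∧ x ∈ V ∧ V ⊆ U ∧ indBelow n ↥(frontier V)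

/-- The small inductive (topological) dimension, with values in `EReal`:
`-1` for the empty space and `⊤` if there is no finite bound. -/
def indDim (X : Type u) [TopologicalSpace X] : EReal :=
  sInf {d : EReal | ∃ n : ℕ, indBelow n X ∧ d = (n : EReal) - 1}

variable {X : Type u} [MetricSpace X]

/-- Topological dimension of a subset of a metric space. -/
def tdim (A : Set X) : EReal := indDim ↥A

open Classical in
/-- Hausdorff dimension of a subset of a metric space,
with the convention `dim ∅ = -1`. -/
def hdim (A : Set X) : EReal := if A = ∅ then -1 else ((dimH A : ℝ≥0∞) : EReal)

/-- A `δ`-packing of `A`: a countable family of pairwise disjoint closed balls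
with centers in `A` and radii at most `δ`. -/
def IsPacking (A : Set X) (δ : ℝ≥0) (s : Set (X × ℝ≥0)) : Prop :=
  s.Countable ∧ (∀ p ∈ s, p.1 ∈ A ∧ p.2 ≤ δ) ∧
    s.Pairwise fun p q => Disjoint (closedBall p.1 (p.2 : ℝ)) (closedBall q.1 (q.2 : ℝ))

/-- The packing pre-measure `P^h_δ(A)`. -/
def packPre (h : ℝ≥0 → ℝ≥0) (A : Set X) (δ : ℝ≥0) : ℝ≥0∞ :=
  ⨆ (s : Set (X × ℝ≥0)) (_ : IsPacking A δ s), ∑' p : s, ((h p.1.2 : ℝ≥0) : ℝ≥0∞)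

/-- The packing pre-measure (packing number) `P^h₀(A) = lim_{δ → 0+} P^h_δ(A)`. -/
def packPre0 (h : ℝ≥0 → ℝ≥0) (A : Set X) : ℝ≥0∞ :=
  ⨅ (δ : ℝ≥0) (_ : 0 < δ), packPre h A δ

/-- The `h`-packing measure `𝒫^h(A)`. -/
def packMeasure (h : ℝ≥0 → ℝ≥0) (A : Set X) : ℝ≥0∞ :=
  ⨅ (c : ℕ → Set X) (_ : A = ⋃ i, c i), ∑' i, packPre0 h (c i)

open Classical in
/-- The packing dimension, with the convention `dim ∅ = -1`. -/
def pdim (A : Set X) : EReal :=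
  if A = ∅ then -1
  else max 0 (⨆ (s : ℝ≥0) (_ : packMeasure (fun r => r ^ (s : ℝ)) A = ∞), ((s : ℝ) : EReal))

/-- The restriction of the packing measure `𝒫^h` to `A` is σ-finite. -/
def PackSigmaFiniteOn (h : ℝ≥0 → ℝ≥0) (A : Set X) : Prop :=
  ∃ c : ℕ → Set X, A ⊆ ⋃ i, c i ∧ ∀ i, packMeasure h (A ∩ c i) < ∞

/-- The generalized Hausdorff measure `ℋ^h(A)` associated to a gauge function `h`. -/
def hMeasure (h : ℝ≥0 → ℝ≥0) (A : Set X) : ℝ≥0∞ :=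
  ⨆ (δ : ℝ≥0) (_ : 0 < δ),
    ⨅ (c : ℕ → Set X) (_ : A ⊆ ⋃ i, c i) (_ : ∀ i, EMetric.diam (c i) ≤ (δ : ℝ≥0∞)),
      ∑' i, ((h (EMetric.diam (c i)).toNNReal : ℝ≥0) : ℝ≥0∞)

/-- `F` is an `F_σ` subset of the subspace `A`. -/
def IsFSigmaIn (F A : Set X) : Prop :=
  ∃ C : ℕ → Set X, (∀ i, IsClosed (C i)) ∧ F = ⋃ i, C i ∩ A

/-- `d^n_*(A) = inf {dim_*(A ∖ F) : F ⊆ A is F_σ in A and dim_T F ≤ n - 1}`. -/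
def dStar (dim : Set X → EReal) (n : ℕ) (A : Set X) : EReal :=
  sInf {d : EReal |
    ∃ F : Set X, IsFSigmaIn F A ∧ tdim F ≤ (n : EReal) - 1 ∧ d = dim (A \ F)}

end

open MeasureTheory Measure

/-- Every set is contained in an open set of almost the same diameter and weight. -/
theorem exists_isOpen_superset_ediam_rpow_le {X : Type*} [MetricSpace X]
    {s : ℝ} (hs : 0 ≤ s) (t : Set X) (ht : ediam t ≠ ∞) {ε η : ℝ≥0∞} (hε : 0 < ε) (hη : 0 < η) :
    ∃ U : Set X, IsOpen U ∧ t ⊆ U ∧ ediam U ≤ ediam t + ε ∧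
      (⨆ _ : U.Nonempty, ediam U ^ s) ≤ (⨆ _ : t.Nonempty, ediam t ^ s) + η := by
  rcases t.eq_empty_or_nonempty with rfl | hne
  · exact ⟨∅, isOpen_empty, Subset.rfl, by simp, by simp⟩
  have hc : Continuous fun x : ℝ≥0 => ediam t + 2 * (x : ℝ≥0∞) :=
    continuous_const.add
      (ENNReal.continuous_const_mul (by simp) |>.comp ENNReal.continuous_coe)
  have hc' : Continuous fun x : ℝ≥0 => (ediam t + 2 * (x : ℝ≥0∞)) ^ s :=
    (ENNReal.continuous_rpow_const (y := s)).comp hc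
  have h₁ : ∀ᶠ x : ℝ≥0 in 𝓝 0, ediam t + 2 * (x : ℝ≥0∞) < ediam t + ε :=
    hc.continuousAt.eventually_lt continuousAt_const
      (by simpa using ENNReal.lt_add_right ht hε.ne')
  have h₂ : ∀ᶠ x : ℝ≥0 in 𝓝 0, (ediam t + 2 * (x : ℝ≥0∞)) ^ s < ediam t ^ s + η :=
    hc'.continuousAt.eventually_lt continuousAt_const
      (by simpa using ENNReal.lt_add_right (ENNReal.rpow_ne_top_of_nonneg hs ht) hη.ne')
  obtain ⟨x, ⟨hx₁, hx₂⟩, hx⟩ : ∃ x : ℝ≥0, (_ ∧ _) ∧ 0 < x :=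
    (((h₁.and h₂).filter_mono nhdsWithin_le_nhds).and
      (self_mem_nhdsWithin : Ioi (0 : ℝ≥0) ∈ 𝓝[>] 0)).exists
  have hd := ediam_thickening_le (s := t) x
  refine ⟨thickening x t, isOpen_thickening, self_subset_thickening (by exact_mod_cast hx) t,
    hd.trans hx₁.le, iSup_le fun _ => ?_⟩
  rw [iSup_pos hne]
  exact (ENNReal.rpow_le_rpow hd hs).trans hx₂.le

section HausdorffMeasure

variable {X : Type*} [MetricSpace X] [MeasurableSpace X] [BorelSpace X]

/-- A Hausdorff null set has countable covers by small sets with small total weight. -/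
theorem exists_cover_of_hausdorffMeasure_eq_zero {s : ℝ} {A : Set X} (hA : μH[s] A = 0)
    {ε : ℝ≥0∞} (hε : 0 < ε) :
    ∃ t : ℕ → Set X, A ⊆ ⋃ n, t n ∧ (∀ n, ediam (t n) ≤ ε) ∧
      ∑' n, (⨆ _ : (t n).Nonempty, ediam (t n) ^ s) < ε := by
  rw [hausdorffMeasure_apply] at hA
  simp only [ENNReal.iSup_eq_zero] at hA
  have h := (hA ε hε).trans_lt hε
  simp only [iInf_lt_iff] at h
  obtain ⟨t, h₁, h₂, h₃⟩ := h
  exact ⟨t, h₁, h₂, h₃⟩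

/-- Converse of `exists_cover_of_hausdorffMeasure_eq_zero`. -/
theorem hausdorffMeasure_eq_zero_of_forall_cover {s : ℝ} {A : Set X}
    (h : ∀ ε : ℝ≥0∞, 0 < ε → ∃ t : ℕ → Set X, A ⊆ ⋃ n, t n ∧ (∀ n, ediam (t n) ≤ ε) ∧
      ∑' n, (⨆ _ : (t n).Nonempty, ediam (t n) ^ s) ≤ ε) : μH[s] A = 0 := by
  rw [hausdorffMeasure_apply]
  simp only [ENNReal.iSup_eq_zero]
  refine fun r hr => nonpos_iff_eq_zero.1 (le_of_forall_gt fun ε hε => ?_)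
  obtain ⟨δ, hδ, hδε⟩ := exists_between hε
  obtain ⟨t, h₁, h₂, h₃⟩ := h (min r δ) (lt_min hr hδ)
  refine lt_of_le_of_lt ?_ hδε
  refine iInf₂_le_of_le t h₁ (iInf_le_of_le (fun n => (h₂ n).trans (min_le_left _ _)) ?_)
  exact h₃.trans (min_le_right _ _)

/-- A Hausdorff null set is contained in a Hausdorff null `G_δ` set. -/
theorem exists_isOpen_iInter_hausdorffMeasure_eq_zero {s : ℝ} (hs : 0 ≤ s) {A : Set X}
    (hA : μH[s] A = 0) :
    ∃ O : ℕ → Set X, (∀ k, IsOpen (O k)) ∧ A ⊆ ⋂ k, O k ∧ μH[s] (⋂ k, O k) = 0 := by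
  have key : ∀ k : ℕ, ∃ U : ℕ → Set X, (∀ n, IsOpen (U n)) ∧ A ⊆ ⋃ n, U n ∧
      (∀ n, ediam (U n) ≤ ((k : ℝ≥0∞) + 1)⁻¹ + (k + 1 : ℝ≥0∞)⁻¹) ∧
      ∑' n, (⨆ _ : (U n).Nonempty, ediam (U n) ^ s) ≤
        ((k : ℝ≥0∞) + 1)⁻¹ + (k + 1 : ℝ≥0∞)⁻¹ := by
    intro k
    have hk : 0 < ((k : ℝ≥0∞) + 1)⁻¹ := by simp
    have hk' : ((k : ℝ≥0∞) + 1)⁻¹ ≠ ∞ := by simp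
    obtain ⟨t, ht, htd, hts⟩ := exists_cover_of_hausdorffMeasure_eq_zero hA hk
    obtain ⟨η, hη, hηs⟩ := ENNReal.exists_pos_sum_of_countable' hk.ne' ℕ
    choose U hUo htU hUd hUs using fun n => exists_isOpen_superset_ediam_rpow_le hs (t n)
      ((htd n).trans_lt hk'.lt_top).ne hk (hη n)
    refine ⟨U, hUo, ht.trans (iUnion_mono htU), fun n => (hUd n).trans (by gcongr; exact htd n),
      (ENNReal.tsum_le_tsum hUs).trans ?_⟩
    rw [ENNReal.tsum_add]
    exact add_le_add hts.le hηs.le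
  choose U hUo hAU hUd hUs using key
  refine ⟨fun k => ⋃ n, U k n, fun k => isOpen_iUnion (hUo k), subset_iInter hAU,
    hausdorffMeasure_eq_zero_of_forall_cover fun ε hε => ?_⟩
  obtain ⟨k, hk⟩ := ENNReal.exists_inv_nat_lt (ENNReal.half_pos hε.ne').ne'
  have hk' : ((k : ℝ≥0∞) + 1)⁻¹ + (k + 1 : ℝ≥0∞)⁻¹ ≤ ε := by
    have : ((k : ℝ≥0∞) + 1)⁻¹ ≤ ε / 2 := (ENNReal.inv_le_inv.2 le_self_add).trans hk.le
    exact (add_le_add this this).trans (ENNReal.add_halves ε).le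
  exact ⟨U k, iInter_subset _ k, fun n => (hUd k n).trans hk', (hUs k).trans hk'⟩

/-- Almost every fibre of a `1`-Lipschitz real function on an `ℋ^(s+1)`-null set is
`ℋ^s`-null. -/
theorem ae_hausdorffMeasure_inter_fiber_eq_zero {s : ℝ} (hs : 0 ≤ s) {A : Set X}
    (hA : μH[s + 1] A = 0) {f : X → ℝ} (hf : LipschitzWith 1 f) :
    ∀ᵐ r : ℝ, μH[s] (A ∩ f ⁻¹' {r}) = 0 := by
  obtain ⟨ε, hε, hεs⟩ := ENNReal.exists_pos_sum_of_countable' one_ne_zero ℕ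
  choose t ht htd hts using fun k => exists_cover_of_hausdorffMeasure_eq_zero hA (hε k)
  set a : ℕ → ℕ → ℝ≥0∞ := fun k i => ⨆ _ : (t k i).Nonempty, ediam (t k i) ^ s with ha
  set T : ℕ → ℕ → Set ℝ := fun k i => toMeasurable volume (f '' t k i) with hT
  have hTm : ∀ k i, MeasurableSet (T k i) := fun k i => measurableSet_toMeasurable _ _
  have hmem : ∀ k i x, x ∈ t k i → f x ∈ T k i := fun k i x hx =>
    subset_toMeasurable _ _ (mem_image_of_mem f hx)
  set g : ℕ → ℝ → ℝ≥0∞ := fun k r => ∑' i, (T k i).indicator (fun _ => a k i) r with hg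
  have hgm : ∀ k, Measurable (g k) := fun k =>
    Measurable.tsum fun i => measurable_const.indicator (hTm k i)
  have hbound : ∀ k, ∫⁻ r, g k r ≤ ε k := by
    intro k
    rw [hg, lintegral_tsum fun i => (measurable_const.indicator (hTm k i)).aemeasurable]
    refine (ENNReal.tsum_le_tsum fun i => ?_).trans (hts k).le
    rw [lintegral_indicator_const (hTm k i), measure_toMeasurable]
    rcases (t k i).eq_empty_or_nonempty with he | hne
    · simp [he]
    · simp only [ha, iSup_pos hne]
      rw [ENNReal.rpow_add_of_nonneg _ _ hs zero_le_one, ENNReal.rpow_one]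
      gcongr
      refine (Real.volume_le_diam _).trans ?_
      simpa using hf.ediam_image_le (t k i)
  have hfin : ∫⁻ r, ∑' k, g k r ≠ ∞ := by
    rw [lintegral_tsum fun k => (hgm k).aemeasurable]
    exact ((ENNReal.tsum_le_tsum hbound).trans_lt (hεs.trans ENNReal.one_lt_top)).ne
  have hε0 : Tendsto ε atTop (𝓝 0) :=
    ENNReal.tendsto_atTop_zero_of_tsum_ne_top (hεs.trans ENNReal.one_lt_top).ne
  filter_upwards [ae_lt_top (Measurable.tsum hgm) hfin] with r hr
  refine hausdorffMeasure_eq_zero_of_forall_cover fun δ hδ => ?_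
  have hg0 : Tendsto (fun k => g k r) atTop (𝓝 0) :=
    ENNReal.tendsto_atTop_zero_of_tsum_ne_top hr.ne
  obtain ⟨k, hk₁, hk₂⟩ := ((hε0.eventually_lt_const hδ).and (hg0.eventually_lt_const hδ)).exists
  refine ⟨fun i => t k i ∩ f ⁻¹' {r}, ?_, fun i => ?_, le_trans ?_ hk₂.le⟩
  · rw [← iUnion_inter]
    exact inter_subset_inter_left _ (ht k)
  · exact (ediam_mono inter_subset_left).trans ((htd k i).trans hk₁.le)
  · refine ENNReal.tsum_le_tsum fun i => iSup_le fun hne => ?_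
    obtain ⟨x, hx, rfl⟩ := hne
    rw [indicator_of_mem (hmem k i x hx)]
    exact (ENNReal.rpow_le_rpow (ediam_mono inter_subset_left) hs).trans
      (le_iSup (fun _ : (t k i).Nonempty => ediam (t k i) ^ s) ⟨x, hx⟩)

end HausdorffMeasure

/-- Small inductive dimension does not increase when passing to a subspace. -/
theorem indBelow_of_isEmbedding {n : ℕ} {Z X : Type*} [TopologicalSpace Z]
    [TopologicalSpace X] {f : Z → X} (hf : IsEmbedding f) (hX : indBelow n X) :
    indBelow n Z := by
  induction n generalizing Z X with
  | zero => exact ⟨fun z => IsEmpty.false (self := hX) (f z)⟩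
  | succ n ih =>
    intro z U hU hz
    obtain ⟨U', hU', rfl⟩ := hf.isOpen_iff.1 hU
    obtain ⟨V, hV, hzV, hVU, hfr⟩ := hX (f z) U' hU' hz
    have hm : MapsTo f (frontier (f ⁻¹' V)) (frontier V) :=
      hf.continuous.frontier_preimage_subset V
    refine ⟨f ⁻¹' V, hV.preimage hf.continuous, hzV, preimage_mono hVU, ih (hf.restrict hm) hfr⟩

/-- Monotonicity of the small inductive dimension for subsets. -/
theorem indBelow_mono {n : ℕ} {X : Type*} [TopologicalSpace X] {A B : Set X} (h : A ⊆ B)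
    (hB : indBelow n B) : indBelow n A :=
  indBelow_of_isEmbedding (IsEmbedding.inclusion h) hB

/-- An `ℋ^(t+n)`-null set has dimension at most `n - 1` after removing an `ℋ^t`-null set. -/
theorem exists_subset_hausdorffMeasure_eq_zero_indBelow {X : Type*} [MetricSpace X]
    [SeparableSpace X] [MeasurableSpace X] [BorelSpace X] {t : ℝ} (ht : 0 ≤ t) (n : ℕ)
    (A : Set X) (hA : μH[t + n] A = 0) :
    ∃ Y : Set X, μH[t] Y = 0 ∧ indBelow n ↥(A \ Y) := by
  induction n generalizing A with
  | zero =>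
    refine ⟨A, by simpa using hA, ?_⟩
    rw [sdiff_self]
    exact inferInstanceAs (IsEmpty (∅ : Set X))
  | succ n ih =>
    have hae : ∀ x : X, ∀ᵐ r : ℝ, μH[t + n] (A ∩ sphere x r) = 0 := fun x =>
      ae_hausdorffMeasure_inter_fiber_eq_zero (by positivity)
        (by rw [add_assoc]; exact_mod_cast hA) (LipschitzWith.dist_left x)
    choose R hRsub hRc hRd using fun x => (dense_of_ae (hae x)).exists_countable_dense_subset
    choose! Y hY0 hYind using fun x r (hr : r ∈ R x) => ih (A ∩ sphere x r) (hRsub x hr)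
    obtain ⟨D, hDc, hDd⟩ := exists_countable_dense X
    refine ⟨⋃ x ∈ D, ⋃ r ∈ R x, Y x r, ?_, ?_⟩
    · exact (measure_biUnion_null_iff hDc).2 fun x _ =>
        (measure_biUnion_null_iff (hRc x)).2 fun r hr => hY0 x r hr
    set W := ⋃ x ∈ D, ⋃ r ∈ R x, Y x r with hW
    intro z U hU hz
    obtain ⟨O, hO, rfl⟩ := isOpen_induced_iff.1 hU
    obtain ⟨ε, hε, hball⟩ := Metric.isOpen_iff.1 hO z.1 hz
    obtain ⟨x, hxD, hx⟩ := hDd.exists_dist_lt z.1 (by positivity : 0 < ε / 2)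
    obtain ⟨r, hr, hr₁, hr₂⟩ := (hRd x).exists_between hx
    refine ⟨Subtype.val ⁻¹' ball x r, isOpen_ball.preimage continuous_subtype_val, hr₁,
      preimage_mono ((ball_subset_ball' ?_).trans hball), ?_⟩
    · rw [dist_comm]
      linarith
    have hm : MapsTo (fun y : ↥(A \ W) => y.1) (frontier ((↑) ⁻¹' ball x r))
        ((A ∩ sphere x r) \ Y x r) := fun y hy =>
      ⟨⟨y.2.1, frontier_ball_subset_sphere
        (continuous_subtype_val.frontier_preimage_subset (ball x r) hy)⟩,
        fun h => y.2.2 (mem_biUnion hxD (mem_biUnion hr h))⟩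
    exact indBelow_of_isEmbedding (IsEmbedding.subtypeVal.restrict hm) (hYind x r hr)

/-- A bound on `indBelow` is a bound on `tdim`. -/
theorem tdim_le_of_indBelow {X : Type*} [MetricSpace X] {n : ℕ} {A : Set X}
    (h : indBelow n A) : tdim A ≤ (n : EReal) - 1 :=
  sInf_le ⟨n, h, rfl⟩

/-- If the whole space is `ℋ^(t+n)`-null, then there is an `F_σ` set of topological dimension
less than `n` with an `ℋ^t`-null complement. -/
theorem exists_isFSigmaIn_compl_hausdorffMeasure_eq_zero {X : Type*} [MetricSpace X]
    [SeparableSpace X] [MeasurableSpace X] [BorelSpace X] {t : ℝ} (ht : 0 ≤ t) (n : ℕ)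
    (hX : μH[t + n] (univ : Set X) = 0) :
    ∃ F : Set X, IsFSigmaIn F univ ∧ tdim F ≤ (n : EReal) - 1 ∧ μH[t] (univ \ F) = 0 := by
  obtain ⟨Y, hY0, hYind⟩ := exists_subset_hausdorffMeasure_eq_zero_indBelow ht n _ hX
  obtain ⟨O, hO, hYO, hO0⟩ := exists_isOpen_iInter_hausdorffMeasure_eq_zero ht hY0
  refine ⟨(⋂ k, O k)ᶜ, ⟨fun k => (O k)ᶜ, fun k => (hO k).isClosed_compl, by simp [compl_iInter]⟩,
    tdim_le_of_indBelow (indBelow_mono ?_ hYind), by rwa [sdiff_compl, univ_inter]⟩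
  rw [← compl_eq_univ_sdiff]
  exact compl_subset_compl.2 hYO

/-- If `dim_T X ≥ n` then `d^n_H(X) ≤ dim_H X - n`. -/
theorem stmt3 (n : ℕ) (hn : 0 < n) (X : Type*) [MetricSpace X]
    [TopologicalSpace.SeparableSpace X]
    (hX : (n : EReal) ≤ tdim (Set.univ : Set X)) :
    dStar hdim n (Set.univ : Set X) ≤ hdim (Set.univ : Set X) - (n : EReal) := by
  borelize X
  have hlt : (n : EReal) - 1 < n := by
    have h : ((n : ℝ) - 1 : ℝ) < (n : ℝ) := by linarith
    simpa using EReal.coe_lt_coe_iff.2 h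
  have hne : (univ : Set X) ≠ ∅ := by
    intro h
    have h0 : indBelow 0 (univ : Set X) := isEmpty_coe_sort.2 h
    have h1 := hX.trans (tdim_le_of_indBelow h0)
    have h2 : ((0 : ℕ) : EReal) - 1 < n :=
      (EReal.sub_le_sub (by exact_mod_cast n.zero_le) le_rfl).trans_lt hlt
    exact h1.not_gt h2
  have hd : hdim (univ : Set X) = ((dimH (univ : Set X) : ℝ≥0∞) : EReal) := if_neg hne
  rw [hd]
  rcases eq_or_ne (dimH (univ : Set X)) ∞ with htop | htop
  · rw [htop, EReal.coe_ennreal_top, EReal.top_sub (EReal.natCast_ne_top n)]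
    exact le_top
  obtain ⟨d, hdeq⟩ : ∃ d : ℝ≥0, (d : ℝ≥0∞) = dimH (univ : Set X) :=
    ⟨_, ENNReal.coe_toNNReal htop⟩
  rw [← hdeq]
  have null : ∀ t : ℝ, 0 ≤ t → (d : ℝ) - n < t → μH[t + n] (univ : Set X) = 0 := by
    intro t ht hdt
    lift t to ℝ≥0 using ht
    have h : dimH (univ : Set X) < ((t + n : ℝ≥0) : ℝ≥0∞) := by
      rw [← hdeq, ENNReal.coe_lt_coe, ← NNReal.coe_lt_coe]
      push_cast
      linarith
    simpa using hausdorffMeasure_of_dimH_lt h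
  have hcast : (((d : ℝ≥0∞) : EReal)) - (n : EReal) = (((d : ℝ) - n : ℝ) : EReal) := by
    rw [EReal.coe_sub]
    rfl
  rw [hcast]
  have hnd : 0 ≤ (d : ℝ) - n := by
    by_contra! hneg
    obtain ⟨F, -, hF, hF0⟩ :=
      exists_isFSigmaIn_compl_hausdorffMeasure_eq_zero le_rfl n (null 0 le_rfl hneg)
    have hFu : F = univ := by
      by_contra hFu
      have hne' : (univ \ F).Nonempty := by
        rwa [← compl_eq_univ_sdiff, nonempty_compl]
      exact one_ne_zero (nonpos_iff_eq_zero.1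
        (hF0 ▸ one_le_hausdorffMeasure_zero_of_nonempty hne'))
    exact (hX.trans (hFu ▸ hF)).not_gt hlt
  refine EReal.le_of_forall_lt_iff_le.1 fun t ht => ?_
  have ht' := EReal.coe_lt_coe_iff.1 ht
  have ht0 : 0 ≤ t := hnd.trans ht'.le
  obtain ⟨F, hFs, hF, hF0⟩ :=
    exists_isFSigmaIn_compl_hausdorffMeasure_eq_zero ht0 n (null t ht0 ht')
  have hle : dStar hdim n (univ : Set X) ≤ hdim (univ \ F) := sInf_le ⟨F, hFs, hF, rfl⟩
  refine hle.trans ?_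
  rw [hdim]
  split_ifs with hemp
  · exact EReal.coe_le_coe_iff.2 (by linarith : (-1 : ℝ) ≤ t)
  lift t to ℝ≥0 using ht0
  have : dimH (univ \ F) ≤ t := dimH_le_of_hausdorffMeasure_ne_top (by simp [hF0])
  exact EReal.coe_ennreal_le_coe_ennreal_iff.2 this
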